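/- arXiv:2006.06423 — 2 statements merged into one kernel-verified Lean document; each statement's English description precedes it below -/
import Mathlib

section
/- Let S be a simple unital ring whose center Z(S) is a field, such that either char(S) ≠ 2 or S is not 4-dimensional over Z(S). Then every proper Lie ideal U of the Lie ring [S,S] is contained in Z(S). -/
namespace Herst

/-- `a` commutes with everything. -/
def Cen {S : Type*} [Ring S] (a : S) : Prop := ∀ s : S, a * s = s * a

variable {S : Type*} [Ring S]

theorem ideal_top (hs : ∀ I : TwoSidedIdeal S, I = ⊥ ∨ I = ⊤) (I : AddSubgroup S)
    (hl : ∀ s, ∀ i ∈ I, s * i ∈ I) (hr : ∀ s, ∀ i ∈ I, i * s ∈ I)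
    (a : S) (ha : a ∈ I) (ha0 : a ≠ 0) (s : S) : s ∈ I := by
  let J : TwoSidedIdeal S := TwoSidedIdeal.mk' (I : Set S) I.zero_mem
    (fun hx hy => I.add_mem hx hy) (fun hx => I.neg_mem hx)
    (fun {x y} hy => hl x y hy) (fun {x y} hx => hr y x hx)
  have hJ : ∀ x, x ∈ J ↔ x ∈ I := fun x => TwoSidedIdeal.mem_mk' _ _ _ _ _ _ x
  rcases hs J with h | h
  · exfalso
    have : a ∈ J := (hJ a).2 ha
    rw [h] at this
    exact ha0 ((TwoSidedIdeal.mem_bot S).1 this)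
  · rw [← hJ, h]; trivial

theorem prime (hs : ∀ I : TwoSidedIdeal S, I = ⊥ ∨ I = ⊤) (a b : S)
    (h : ∀ s, a * s * b = 0) : a = 0 ∨ b = 0 := by
  by_cases hb : b = 0
  · exact Or.inr hb
  left
  let I : AddSubgroup S :=
    { carrier := {x | ∀ s, a * s * x = 0}
      zero_mem' := by intro s; simp
      add_mem' := by intro x y hx hy s; rw [mul_add, hx, hy, add_zero]
      neg_mem' := by intro x hx s; rw [mul_neg, hx, neg_zero] }
  have := ideal_top hs I (fun s i hi t => by
      have := hi (t * s); simpa [mul_assoc] using this) (fun s i hi t => by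
      have := hi t; rw [← mul_assoc, this, zero_mul]) b h hb 1
  simpa using this 1

theorem two_cancel (hs : ∀ I : TwoSidedIdeal S, I = ⊥ ∨ I = ⊤) (h2 : (2 : S) ≠ 0)
    (a : S) (h : a + a = 0) : a = 0 := by
  refine (prime hs 2 a fun s => ?_).resolve_left h2
  have : s * (a + a) = 0 := by rw [h, mul_zero]
  linear_combination (norm := noncomm_ring) this

theorem cen_unit (hc : IsField (Subring.center S)) (z : S) (hz : Cen z) (h0 : z ≠ 0) :
    ∃ z', Cen z' ∧ z * z' = 1 := by
  have hm : z ∈ Subring.center S := Subring.mem_center_iff.2 fun g => (hz g).symm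
  obtain ⟨b, hb⟩ := hc.mul_inv_cancel (a := ⟨z, hm⟩) (by
    intro h; exact h0 (congrArg Subtype.val h))
  exact ⟨b, fun s => (Subring.mem_center_iff.1 b.2 s).symm, congrArg Subtype.val hb⟩

theorem cen_of_mul (hc : IsField (Subring.center S)) (z a : S) (hz : Cen z) (h0 : z ≠ 0)
    (h : Cen (a * z)) : Cen a := by
  obtain ⟨z', hz', h1⟩ := cen_unit hc z hz h0
  intro s
  have h3 := h s
  have : a = a * z * z' := by rw [mul_assoc, h1, mul_one]
  rw [this, mul_assoc, hz' s, ← mul_assoc, h3, mul_assoc]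

/-- If `[x,y]` and `[x,x*y]` are central then `[x,y]=0`. -/
theorem comm_zero (hc : IsField (Subring.center S)) (x y : S) (h1 : Cen (x * y - y * x))
    (h2 : Cen (x * (x * y) - (x * y) * x)) : x * y = y * x := by
  by_contra h
  have h0 : x * y - y * x ≠ 0 := sub_ne_zero.2 h
  have : Cen x := cen_of_mul hc _ x h1 h0 (by
    have : x * (x * y - y * x) = x * (x * y) - (x * y) * x := by noncomm_ring
    rwa [this])
  exact h (this y)

theorem sq_zero (hs : ∀ I : TwoSidedIdeal S, I = ⊥ ∨ I = ⊤) (C : AddSubgroup S)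
    (hC : ∀ a b : S, a * b - b * a ∈ C) (y : S) (hy : y * y = 0)
    (h : ∀ c ∈ C, (y * c - c * y) * (y * c - c * y) = 0) : y = 0 := by
  by_contra hy0
  let I : AddSubgroup S :=
    { carrier := {i | ∀ a b, ∃ c ∈ C, y * (a * i * b) * y = y * c * y}
      zero_mem' := by intro a b; exact ⟨0, C.zero_mem, by simp⟩
      add_mem' := by
        intro i j hi hj a b
        obtain ⟨c, hc, h1⟩ := hi a b
        obtain ⟨d, hd, h2⟩ := hj a b
        refine ⟨c + d, C.add_mem hc hd, ?_⟩
        linear_combination (norm := noncomm_ring) h1 + h2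
      neg_mem' := by
        intro i hi a b
        obtain ⟨c, hc, h1⟩ := hi a b
        refine ⟨-c, C.neg_mem hc, ?_⟩
        linear_combination (norm := noncomm_ring) -h1 }
  have hI : ∀ s, s ∈ I := ideal_top hs I
    (fun s i hi a b => by
      obtain ⟨c, hc, h1⟩ := hi (a * s) b
      exact ⟨c, hc, by rw [← h1]; noncomm_ring⟩)
    (fun s i hi a b => by
      obtain ⟨c, hc, h1⟩ := hi a (s * b)
      exact ⟨c, hc, by rw [← h1]; noncomm_ring⟩)
    y (fun a b => ⟨(a * y) * b - b * (a * y), hC _ _, by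
      have : y * (a * y * b - b * (a * y)) * y = y * (a * y * b) * y - y * b * a * (y * y) := by
        noncomm_ring
      rw [this, hy]; simp⟩) hy0
  have hI' : ∀ s, ∃ c ∈ C, y * s * y = y * c * y := fun s => by
    obtain ⟨c, hc, h1⟩ := hI s 1 1
    exact ⟨c, hc, by simpa using h1⟩
  have h1 : ∀ c ∈ C, y * c * y * c * y = 0 := fun c hc => by
    have := congrArg (fun t => y * t) (h c hc)
    simp only [mul_zero] at this
    have e : y * ((y * c - c * y) * (y * c - c * y)) =
      (y * y) * (c * y * c) - (y * y) * (c * c * y) - y * c * (y * y) * c + y * c * y * c * y := by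
        noncomm_ring
    rw [e, hy] at this
    simpa using this
  have h1' : ∀ s, y * s * y * s * y = 0 := fun s => by
    obtain ⟨c, hc, e⟩ := hI' s
    have e2 : y * s * y * s * y = y * c * y * c * y := by
      linear_combination (norm := noncomm_ring) e * (s * y) + (y * c) * e
    rw [e2, h1 c hc]
  have h2 : ∀ s t, y * s * y * t * y + y * t * y * s * y = 0 := fun s t => by
    linear_combination (norm := noncomm_ring) h1' (s + t) - h1' s - h1' t
  have h3 : ∀ s, y * s * y = 0 := fun s => by
    refine (or_self_iff).1 (prime hs _ _ fun t => ?_)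
    have a := congrArg (fun r => y * s * r) (h2 s t)
    have b := congrArg (fun r => r * t * y) (h1' s)
    simp only [mul_zero, zero_mul] at a b
    linear_combination (norm := noncomm_ring) a - b
  exact hy0 ((or_self_iff).1 (prime hs _ _ h3))

theorem d2zero (hs : ∀ I : TwoSidedIdeal S, I = ⊥ ∨ I = ⊤) (h2 : (2 : S) ≠ 0) (x : S)
    (h : ∀ s, x * (x * s - s * x) - (x * s - s * x) * x = 0) : Cen x := by
  have h1 : ∀ s t, (x * s - s * x) * (x * t - t * x) = 0 := fun s t => by
    apply two_cancel hs h2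
    have a := congrArg (fun r => r * t) (h s)
    have b := congrArg (fun r => s * r) (h t)
    simp only [mul_zero, zero_mul] at a b
    linear_combination (norm := noncomm_ring) h (s * t) - a - b
  intro s
  refine sub_eq_zero.1 ((or_self_iff).1 (prime hs _ _ fun t => ?_))
  have a := congrArg (fun r => r * s) (h1 s t)
  simp only [zero_mul] at a
  linear_combination (norm := noncomm_ring) h1 s (t * s) - a

theorem neg2 (h2 : (2 : S) = 0) (a : S) : a + a = 0 := by
  have := congrArg (fun r => r * a) h2
  simpa [two_mul] using this

theorem dim4 [Nontrivial S] (h2 : (2 : S) = 0) (x w : S) (hx : Cen (x * x))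
    (hw : x * w - w * x = 1)
    (hA : ∀ a b, a * x = x * a → b * x = x * b → a * b = b * a) :
    Module.finrank (Subring.center S) S = 4 := by
  have n2 := neg2 h2
  have hwx : w * x = x * w + 1 := by
    linear_combination (norm := noncomm_ring) (-1 : S) * hw - n2 1
  have hdx : ∀ s, (x * s - s * x) * x = x * (x * s - s * x) := fun s => by
    linear_combination (norm := noncomm_ring) n2 (x * s * x) - hx s - n2 (s * (x * x))
  have hb : ∀ s, (s - (x * s - s * x) * w) * x = x * (s - (x * s - s * x) * w) := fun s => by
    linear_combination (norm := noncomm_ring)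
      -hdx s * w + (x * s - s * x) * hw
  have hcen : ∀ p, p * x = x * p → p * w = w * p → Cen p := fun p h1 h2 s => by
    have e1 := hA p _ h1 (hb s)
    have e2 := hA p _ h1 (hdx s)
    linear_combination (norm := noncomm_ring) e1 + e2 * w + (x * s - s * x) * h2
  have hww : (w * w) * x = x * (w * w) := by
    linear_combination (norm := noncomm_ring) - hw * w - w * hw - n2 w
  have hdel : ∀ a, a * x = x * a → (w * a - a * w) * x = x * (w * a - a * w) := fun a ha => by
    linear_combination (norm := noncomm_ring) w * ha - ha * w - hw * a + a * hw
  have hdec : ∀ a, a * x = x * a → ∃ p q, Cen p ∧ Cen q ∧ a = p + q * x := fun a ha => by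
    have hq : Cen (w * a - a * w) := hcen _ (hdel a ha) (by
      linear_combination (norm := noncomm_ring) -hA a _ ha hww + n2 (w * a * w) - n2 (w * w * a))
    refine ⟨a - (w * a - a * w) * x, w * a - a * w, hcen _ ?_ ?_, hq, by noncomm_ring⟩
    · linear_combination (norm := noncomm_ring) ha - hdel a ha * x
    · linear_combination (norm := noncomm_ring) -hq w * x - (w * a - a * w) * hw - n2 (w * a - a * w)
  have hspan : ∀ s, ∃ p q r t, Cen p ∧ Cen q ∧ Cen r ∧ Cen t ∧
      s = p + q * x + r * w + t * (x * w) := fun s => by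
    obtain ⟨p, q, hp, hq, h1⟩ := hdec _ (hb s)
    obtain ⟨r, t, hr, ht, h2⟩ := hdec _ (hdx s)
    refine ⟨p, q, r, t, hp, hq, hr, ht, ?_⟩
    linear_combination (norm := noncomm_ring) h1 + h2 * w
  have hmem : ∀ {p : S}, Cen p → p ∈ Subring.center S := fun hp =>
    Subring.mem_center_iff.2 fun g => (hp g).symm
  have hli : LinearIndependent (Subring.center S) ![1, x, w, x * w] := by
    rw [Fintype.linearIndependent_iff]
    intro g hg
    have hgc : ∀ i, Cen (g i : S) := fun i s => (Subring.mem_center_iff.1 (g i).2 s).symm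
    simp only [Fin.sum_univ_four, Subring.smul_def, smul_eq_mul, Matrix.cons_val] at hg
    have c0 := hgc 0
    have c1 := hgc 1
    have c2 := hgc 2
    have c3 := hgc 3
    have key : (g 0 : S) = 0 ∧ (g 1 : S) = 0 ∧ (g 2 : S) = 0 ∧ (g 3 : S) = 0 := by
      generalize (g 0 : S) = p at *
      generalize (g 1 : S) = q at *
      generalize (g 2 : S) = r at *
      generalize (g 3 : S) = t at *
      have e1 : r + t * x = 0 := by
        linear_combination (norm := noncomm_ring) x * hg - hg * x + c0 x + c1 x * x
          + c2 x * w + c3 x * (x * w) - r * hw - t * x * hw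
      have e2 : t = 0 := by
        linear_combination (norm := noncomm_ring) e1 * w - w * e1 - c2 w - c3 w * x - t * hw
      have e3 : r = 0 := by simpa [e2] using e1
      rw [e2, e3] at hg
      have e4 : p + q * x = 0 := by simpa using hg
      have e5 : q = 0 := by
        linear_combination (norm := noncomm_ring) e4 * w - w * e4 - c0 w - c1 w * x - q * hw
      exact ⟨by simpa [e5] using e4, e5, e3, e2⟩
    intro i
    apply Subtype.ext
    fin_cases i
    · exact key.1
    · exact key.2.1
    · exact key.2.2.1
    · exact key.2.2.2
  have hsp : ⊤ ≤ Submodule.span (Subring.center S) (Set.range ![1, x, w, x * w]) := by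
    intro s _
    obtain ⟨p, q, r, t, hp, hq, hr, ht, h⟩ := hspan s
    have : s = ∑ i, (![⟨p, hmem hp⟩, ⟨q, hmem hq⟩, ⟨r, hmem hr⟩, ⟨t, hmem ht⟩] :
        Fin 4 → Subring.center S) i • ![1, x, w, x * w] i := by
      simp only [Fin.sum_univ_four, Subring.smul_def, smul_eq_mul, Matrix.cons_val, mul_one]
      exact h
    rw [this]
    exact Submodule.sum_mem _ fun i _ => Submodule.smul_mem _ _
      (Submodule.subset_span ⟨i, rfl⟩)
  simpa using Module.finrank_eq_card_basis (Module.Basis.mk hli hsp)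

theorem gen [Nontrivial S] (hs : ∀ I : TwoSidedIdeal S, I = ⊥ ∨ I = ⊤)
    (hc : IsField (Subring.center S))
    (hd : (2 : S) ≠ 0 ∨ Module.finrank (Subring.center S) S ≠ 4)
    (hnc : ∃ p q : S, p * q ≠ q * p) (G : Subring S)
    (hG : ∀ a b : S, a * b - b * a ∈ G) (s : S) : s ∈ G := by
  by_cases hcomm : ∀ u ∈ G, ∀ v ∈ G, u * v = v * u
  · exfalso
    obtain ⟨p, q, hpq⟩ := hnc
    have hcen : ∀ p q : S, Cen (p * q - q * p) := by
      intro p q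
      by_cases h2 : (2 : S) = 0
      · have hd4 := hd.resolve_left (not_not.2 h2)
        have n2 := neg2 h2
        have hsq : ∀ x, x ∈ G → Cen (x * x) := fun x hx s => by
          linear_combination (norm := noncomm_ring) hcomm _ hx _ (hG x s) +
            n2 (x * s * x) - n2 (s * x * x)
        have hy : ∀ x ∈ G, ∀ s, (x * s - s * x) * (x * s - s * x) = 0 := by
          intro x hx s
          by_contra h0
          obtain ⟨z, hz, h1⟩ := cen_unit hc _ (hsq _ (hG x s)) h0
          have hw : x * (s * (x * s - s * x) * z) - s * (x * s - s * x) * z * x = 1 := by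
            linear_combination (norm := noncomm_ring) h1 - s * (x * s - s * x) * hz x
              + s * hcomm _ hx _ (hG x s) * z
          refine hd4 (dim4 h2 x _ (hsq x hx) hw ?_)
          have hAG : ∀ a, a * x = x * a → a ∈ G := fun a ha => by
            have := hG x (a * (s * (x * s - s * x) * z))
            convert this using 1
            linear_combination (norm := noncomm_ring) -a * hw + ha * (s * (x * s - s * x) * z)
          exact fun a b ha hb => hcomm _ (hAG a ha) _ (hAG b hb)
        intro s
        refine sub_eq_zero.1 (sq_zero hs ⊤ (fun _ _ => trivial) _ (hy _ (hG p q) s) ?_)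
        exact fun c _ => hy _ (hG _ _) c
      · apply d2zero hs h2
        intro s
        exact sub_eq_zero.2 (hcomm _ (hG _ _) _ (hG _ _))
    exact hpq (comm_zero hc p q (hcen _ _) (hcen _ _))
  · push Not at hcomm
    obtain ⟨u, hu, v, hv, huv⟩ := hcomm
    let I : AddSubgroup S :=
      { carrier := {i | ∀ a b, a * i * b ∈ G}
        zero_mem' := by intro a b; simp
        add_mem' := by
          intro i j hi hj a b
          rw [mul_add, add_mul]; exact G.add_mem (hi a b) (hj a b)
        neg_mem' := by
          intro i hi a b
          rw [mul_neg, neg_mul]; exact G.neg_mem (hi a b) }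
    have h1 : ∀ b, (u * v - v * u) * b ∈ G := fun b => by
      have : (u * v - v * u) * b = (u * (v * b) - (v * b) * u) - v * (u * b - b * u) := by
        noncomm_ring
      rw [this]
      exact G.sub_mem (hG _ _) (G.mul_mem hv (hG _ _))
    have := ideal_top hs I
      (fun s i hi a b => by have := hi (a * s) b; rwa [mul_assoc a s i] at this)
      (fun s i hi a b => by have := hi a (s * b); rwa [← mul_assoc, mul_assoc a i s] at this)
      (u * v - v * u) (fun a b => by
        have : a * (u * v - v * u) * b = (a * ((u * v - v * u) * b) - ((u * v - v * u) * b) * a)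
          + (u * v - v * u) * (b * a) := by noncomm_ring
        rw [this]
        exact G.add_mem (hG _ _) (h1 _)) (sub_ne_zero.2 huv) s
    simpa using this 1 1

theorem cen_of_comm [Nontrivial S] (hs : ∀ I : TwoSidedIdeal S, I = ⊥ ∨ I = ⊤)
    (hc : IsField (Subring.center S))
    (hd : (2 : S) ≠ 0 ∨ Module.finrank (Subring.center S) S ≠ 4)
    (hnc : ∃ p q : S, p * q ≠ q * p) (x : S)
    (h : ∀ a b : S, x * (a * b - b * a) = (a * b - b * a) * x) : Cen x := by
  intro s
  have := gen hs hc hd hnc (Subring.centralizer {x}) (fun a b => by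
    rw [Subring.mem_centralizer_iff]
    rintro _ rfl
    exact h a b) s
  rw [Subring.mem_centralizer_iff] at this
  exact this x rfl

/-- `a + x [w,a]` as an explicit commutator. -/
theorem P_id (x w a : S) (hw : x * w - w * x = 1) (ha : a * x = x * a) :
    a + x * (w * a - a * w) =
      ((a * w) * (x * w) - (x * w) * (a * w)) * x - x * ((a * w) * (x * w) - (x * w) * (a * w)) := by
  linear_combination (norm := noncomm_ring) -ha * (w * x * w) + a * hw * (x * w) + (a * w * x) * hw
    - x * hw * (a * w) + x * w * ha * w - x * w * a * hw - a * hw + ha * w + ha * w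

theorem lemL [Nontrivial S] (hs : ∀ I : TwoSidedIdeal S, I = ⊥ ∨ I = ⊤)
    (hc : IsField (Subring.center S))
    (hd : (2 : S) ≠ 0 ∨ Module.finrank (Subring.center S) S ≠ 4)
    (hnc : ∃ p q : S, p * q ≠ q * p) (C : AddSubgroup S)
    (hC : ∀ a b : S, a * b - b * a ∈ C) (T : Subring S)
    (hT : ∀ t ∈ T, ∀ c ∈ C, t * c - c * t ∈ T)
    (hcomm : ∀ u ∈ T, ∀ v ∈ T, u * v = v * u) (x : S) (hx : x ∈ T) : Cen x := by
  have hsq : ∀ x ∈ T, ∀ c ∈ C, (x * c - c * x) * (x * c - c * x) = 0 := by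
    intro x hx c hcc
    by_cases h2 : (2 : S) = 0
    · have hd4 := hd.resolve_left (not_not.2 h2)
      have n2 := neg2 h2
      have hsq : ∀ x, x ∈ T → Cen (x * x) := fun x hx => by
        apply cen_of_comm hs hc hd hnc
        intro a b
        have := hcomm _ hx _ (hT x hx _ (hC a b))
        generalize a * b - b * a = s at *
        linear_combination (norm := noncomm_ring) this +
            n2 (x * s * x) - n2 (s * x * x)
      by_contra h0
      have hyT := hT x hx c hcc
      obtain ⟨z, hz, h1⟩ := cen_unit hc _ (hsq _ hyT) h0
      have hxy := hcomm _ hx _ hyT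
      obtain ⟨w, hwd⟩ : ∃ w, w = c * (x * c - c * x) * z := ⟨_, rfl⟩
      have hwC : w ∈ C := by
        have := hC (c * x) (c * z)
        convert this using 1
        rw [hwd]
        linear_combination (norm := noncomm_ring) c * hz (c * x)
      have hw : x * w - w * x = 1 := by
        rw [hwd]
        linear_combination (norm := noncomm_ring) h1 - c * (x * c - c * x) * hz x
              + c * hxy * z
      refine hd4 (dim4 h2 x w (hsq x hx) hw ?_)
      have hP : ∀ a, a * x = x * a → a + x * (w * a - a * w) ∈ T := fun a ha => by
        rw [P_id x w a hw ha]
        have := T.neg_mem (hT x hx _ (hC (a * w) (x * w)))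
        rwa [neg_sub] at this
      have hdel : ∀ a, a * x = x * a → (w * a - a * w) * x = x * (w * a - a * w) := fun a ha => by
        linear_combination (norm := noncomm_ring) w * ha - ha * w - hw * a + a * hw
      have hAT : ∀ a, a * x = x * a → a ∈ T := fun a ha => by
        have e1 := hP a ha
        have e2 := hP _ (hdel a ha)
        have e3 := hT _ e1 w hwC
        have e4 : w * a - a * w ∈ T := by
          have := T.add_mem e2 e3
          convert this using 1
          linear_combination (norm := noncomm_ring) -hw * (w * a - a * w)
        have := T.sub_mem e1 (T.mul_mem hx e4)
        rwa [add_sub_cancel_right] at this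
      exact fun a b ha hb => hcomm _ (hAT a ha) _ (hAT b hb)
    · have d2 : ∀ c ∈ C, x * (x * c - c * x) = (x * c - c * x) * x := fun c hcc =>
        hcomm _ hx _ (hT x hx c hcc)
      have k1 : ∀ t, (x * (c * t - t * c) - (c * t - t * c) * x) * (x * c - c * x) = 0 := by
        intro t
        apply two_cancel hs h2
        have a := d2 _ (hC c (t * c))
        have b := d2 _ (hC c t)
        have e := d2 c hcc
        linear_combination (norm := noncomm_ring) a - b * c - (c * t - t * c) * e
      have k2 : ∀ t, (x * t - t * x) * ((x * c - c * x) * (x * c - c * x)) = 0 := by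
        intro t
        have a := k1 (t * x)
        have e := d2 c hcc
        linear_combination (norm := noncomm_ring) -a + k1 t * x - t * e * (x * c - c * x)
          + (x * (c * t - t * c) - (c * t - t * c) * x) * e
      rcases em (∀ s, x * s = s * x) with h | h
      · rw [h c]; simp
      · push Not at h
        obtain ⟨s, hs'⟩ := h
        refine (prime hs (x * s - s * x) _ fun t => ?_).resolve_left (sub_ne_zero.2 hs')
        linear_combination (norm := noncomm_ring) k2 (s * t) - s * k2 t
  have h0 : ∀ c ∈ C, x * c - c * x = 0 := fun c hcc => by
    refine sq_zero hs C hC _ (hsq x hx c hcc) fun d hdd => hsq _ (hT x hx c hcc) d hdd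
  exact cen_of_comm hs hc hd hnc x fun a b => sub_eq_zero.1 (h0 _ (hC a b))

theorem lemL' [Nontrivial S] (hs : ∀ I : TwoSidedIdeal S, I = ⊥ ∨ I = ⊤)
    (hc : IsField (Subring.center S))
    (hd : (2 : S) ≠ 0 ∨ Module.finrank (Subring.center S) S ≠ 4)
    (hnc : ∃ p q : S, p * q ≠ q * p) (C : AddSubgroup S)
    (hC : ∀ a b : S, a * b - b * a ∈ C) (X : Set S)
    (hX : ∀ t ∈ X, ∀ c ∈ C, t * c - c * t ∈ Subring.closure X)
    (hcomm : ∀ u ∈ X, ∀ v ∈ X, u * v = v * u) (x : S) (hx : x ∈ X) : Cen x := by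
  refine lemL hs hc hd hnc C hC (Subring.closure X) ?_ ?_ x (Subring.subset_closure hx)
  · intro t ht c hcc
    induction ht using Subring.closure_induction with
    | mem t ht => exact hX t ht c hcc
    | zero => simp
    | one => simp
    | add a b _ _ ha hb =>
      have : (a + b) * c - c * (a + b) = (a * c - c * a) + (b * c - c * b) := by noncomm_ring
      rw [this]; exact Subring.add_mem _ ha hb
    | neg a _ ha =>
      have : (-a) * c - c * (-a) = -(a * c - c * a) := by noncomm_ring
      rw [this]; exact Subring.neg_mem _ ha
    | mul a b ha' hb' ha hb =>
      have : (a * b) * c - c * (a * b) = (a * c - c * a) * b + a * (b * c - c * b) := by noncomm_ring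
      rw [this]; exact Subring.add_mem _ (Subring.mul_mem _ ha hb') (Subring.mul_mem _ ha' hb)
  · have h1 : Subring.closure X ≤ Subring.centralizer X :=
      Subring.closure_le.2 fun u hu => Subring.mem_centralizer_iff.2 fun v hv => hcomm v hv u hu
    have h2 : Subring.closure X ≤ Subring.centralizer (Subring.closure X : Set S) :=
      Subring.closure_le.2 fun u hu => Subring.mem_centralizer_iff.2 fun v hv =>
        ((Subring.mem_centralizer_iff.1 (h1 hv)) u hu).symm
    exact fun u hu v hv => Subring.mem_centralizer_iff.1 (h2 hv) u hu

theorem thmT [Nontrivial S] (hs : ∀ I : TwoSidedIdeal S, I = ⊥ ∨ I = ⊤)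
    (hc : IsField (Subring.center S))
    (hd : (2 : S) ≠ 0 ∨ Module.finrank (Subring.center S) S ≠ 4)
    (hnc : ∃ p q : S, p * q ≠ q * p) (C : AddSubgroup S)
    (hC : ∀ a b : S, a * b - b * a ∈ C) (T : Subring S)
    (hT : ∀ t ∈ T, ∀ c ∈ C, t * c - c * t ∈ T)
    (hne : ∃ s, s ∉ T) (x : S) (hx : x ∈ T) : Cen x := by
  let T0 : Subring S :=
    { carrier := {x | x ∈ T ∧ ∀ s, x * s - s * x ∈ T}
      zero_mem' := ⟨T.zero_mem, by simp⟩
      one_mem' := ⟨T.one_mem, by simp⟩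
      add_mem' := by
        rintro a b ⟨ha, ha'⟩ ⟨hb, hb'⟩
        refine ⟨T.add_mem ha hb, fun s => ?_⟩
        have : (a + b) * s - s * (a + b) = (a * s - s * a) + (b * s - s * b) := by noncomm_ring
        rw [this]; exact T.add_mem (ha' s) (hb' s)
      neg_mem' := by
        rintro a ⟨ha, ha'⟩
        refine ⟨T.neg_mem ha, fun s => ?_⟩
        have : (-a) * s - s * (-a) = -(a * s - s * a) := by noncomm_ring
        rw [this]; exact T.neg_mem (ha' s)
      mul_mem' := by
        rintro a b ⟨ha, ha'⟩ ⟨hb, hb'⟩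
        refine ⟨T.mul_mem ha hb, fun s => ?_⟩
        have : (a * b) * s - s * (a * b) = (a * s - s * a) * b + a * (b * s - s * b) := by
          noncomm_ring
        rw [this]; exact T.add_mem (T.mul_mem (ha' s) hb) (T.mul_mem ha (hb' s)) }
  let J : AddSubgroup S :=
    { carrier := {r | ∀ s, r * s ∈ T}
      zero_mem' := by intro s; simp
      add_mem' := by intro a b ha hb s; rw [add_mul]; exact T.add_mem (ha s) (hb s)
      neg_mem' := by intro a ha s; rw [neg_mul]; exact T.neg_mem (ha s) }
  let G : Subring S :=
    { carrier := {g | ∀ r ∈ J, g * r ∈ J}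
      zero_mem' := by intro r _; rw [zero_mul]; exact J.zero_mem
      one_mem' := by intro r hr; rwa [one_mul]
      add_mem' := by intro a b ha hb r hr; rw [add_mul]; exact J.add_mem (ha r hr) (hb r hr)
      neg_mem' := by intro a ha r hr; rw [neg_mul]; exact J.neg_mem (ha r hr)
      mul_mem' := by intro a b ha hb r hr; rw [mul_assoc]; exact ha _ (hb r hr) }
  have hG : ∀ g, g ∈ G := gen hs hc hd hnc G fun a b r hr s => by
    have e1 := hT _ (hr s) _ (hC a b)
    have e2 := hr (s * (a * b - b * a))
    have := T.sub_mem e2 e1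
    convert this using 1
    noncomm_ring
  have hJ : ∀ j ∈ J, j = 0 := fun j hj => by
    by_contra h0
    obtain ⟨s, hsT⟩ := hne
    have := ideal_top hs J (fun s i hi => hG s i hi) (fun s i hi t => by
      rw [mul_assoc]; exact hi _) j hj h0 s 1
    exact hsT (by simpa using this)
  have hT0T : ∀ a ∈ T0, ∀ b ∈ T, a * b = b * a := fun a ha b hb => by
    refine sub_eq_zero.1 (hJ _ fun s => ?_)
    have : (a * b - b * a) * s = (a * (b * s) - (b * s) * a) - b * (a * s - s * a) := by
      noncomm_ring
    rw [this]
    exact T.sub_mem (ha.2 _) (T.mul_mem hb (ha.2 s))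
  have hT0 : ∀ a ∈ T0, Cen a := lemL hs hc hd hnc C hC T0 (fun t ht c hcc => by
      refine ⟨ht.2 c, fun s => ?_⟩
      have : (t * c - c * t) * s - s * (t * c - c * t) =
        (t * (c * s - s * c) - (c * s - s * c) * t) + ((t * s - s * t) * c - c * (t * s - s * t)) := by
        noncomm_ring
      rw [this]
      exact T.add_mem (ht.2 _) (hT _ (ht.2 s) c hcc))
    (fun u hu v hv => hT0T u hu v hv.1)
  have hTT : ∀ u ∈ T, ∀ v ∈ T, Cen (u * v - v * u) := fun u hu v hv => hT0 _ (by
    refine ⟨T.sub_mem (T.mul_mem hu hv) (T.mul_mem hv hu), fun s => ?_⟩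
    have : (u * v - v * u) * s - s * (u * v - v * u) =
      (u * (v * s - s * v) - (v * s - s * v) * u) - (v * (u * s - s * u) - (u * s - s * u) * v) := by
      noncomm_ring
    rw [this]
    exact T.sub_mem (hT u hu _ (hC _ _)) (hT v hv _ (hC _ _)))
  exact lemL hs hc hd hnc C hC T hT (fun u hu v hv =>
    comm_zero hc u v (hTT u hu v hv) (hTT u hu _ (T.mul_mem hu hv))) x hx

theorem final [Nontrivial S] (hs : ∀ I : TwoSidedIdeal S, I = ⊥ ∨ I = ⊤)
    (hc : IsField (Subring.center S))
    (hd : (2 : S) ≠ 0 ∨ Module.finrank (Subring.center S) S ≠ 4)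
    (hnc : ∃ p q : S, p * q ≠ q * p) (C : AddSubgroup S)
    (hC : ∀ a b : S, a * b - b * a ∈ C) (U : AddSubgroup S)
    (hU : ∀ x ∈ C, ∀ y ∈ U, x * y - y * x ∈ U)
    (hne : ∃ a b : S, a * b - b * a ∉ U) (x : S) (hx : x ∈ U) : Cen x := by
  have hU' : ∀ y ∈ U, ∀ x ∈ C, y * x - x * y ∈ U := fun y hy x hx => by
    have := U.neg_mem (hU x hx y hy); rwa [neg_sub] at this
  let T : Subring S :=
    { carrier := {x | ∀ s, x * s - s * x ∈ U}
      zero_mem' := by intro s; simp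
      one_mem' := by intro s; simp
      add_mem' := by
        intro a b ha hb s
        have : (a + b) * s - s * (a + b) = (a * s - s * a) + (b * s - s * b) := by noncomm_ring
        rw [this]; exact U.add_mem (ha s) (hb s)
      neg_mem' := by
        intro a ha s
        have : (-a) * s - s * (-a) = -(a * s - s * a) := by noncomm_ring
        rw [this]; exact U.neg_mem (ha s)
      mul_mem' := by
        intro a b ha hb s
        have : (a * b) * s - s * (a * b) = (a * (b * s) - (b * s) * a) + (b * (s * a) - (s * a) * b) := by
          noncomm_ring
        rw [this]; exact U.add_mem (ha _) (hb _) }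
  have hTcen : ∀ t ∈ T, Cen t := thmT hs hc hd hnc C hC T (fun t ht c hcc s => by
      have : (t * c - c * t) * s - s * (t * c - c * t) =
        (t * (c * s - s * c) - (c * s - s * c) * t) + ((t * s - s * t) * c - c * (t * s - s * t)) := by
        noncomm_ring
      rw [this]
      exact U.add_mem (ht _) (hU' _ (ht s) c hcc))
    (by obtain ⟨a, b, hab⟩ := hne; exact ⟨a, fun h => hab (h b)⟩)
  have hUU : ∀ u ∈ U, ∀ v ∈ U, Cen (u * v - v * u) := fun u hu v hv => hTcen _ (by
    intro s
    have : (u * v - v * u) * s - s * (u * v - v * u) =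
      (u * (v * s - s * v) - (v * s - s * v) * u) - (v * (u * s - s * u) - (u * s - s * u) * v) := by
      noncomm_ring
    rw [this]
    exact U.sub_mem (hU' u hu _ (hC _ _)) (hU' v hv _ (hC _ _)))
  by_cases h0 : ∀ u ∈ U, ∀ v ∈ U, u * v = v * u
  · exact lemL' hs hc hd hnc C hC U (fun t ht c hcc => Subring.subset_closure (hU' t ht c hcc))
      h0 x hx
  exfalso
  push Not at h0
  obtain ⟨u, hu, v, hv, huv⟩ := h0
  have hz := hUU u hu v hv
  have hz0 : u * v - v * u ≠ 0 := sub_ne_zero.2 huv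
  obtain ⟨z, hzd⟩ : ∃ z, z = u * v - v * u := ⟨_, rfl⟩
  rw [← hzd] at hz hz0
  obtain ⟨y, hy, hzy⟩ := cen_unit hc z hz hz0
  have hyz : y * z = 1 := by rw [hy, hzy]
  by_cases h2 : (2 : S) = 0
  · have hd4 := hd.resolve_left (not_not.2 h2)
    have n2 := neg2 h2
    have hsq : ∀ u ∈ U, Cen (u * u) := fun u hu => by
      have hq : ∀ c ∈ C, Cen (u * u * c - c * (u * u)) := fun c hcc => by
        have := hUU u hu _ (hU' u hu c hcc)
        have e : u * u * c - c * (u * u) = u * (u * c - c * u) - (u * c - c * u) * u := by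
          linear_combination (norm := noncomm_ring) n2 (u * c * u) - n2 (c * u * u)
        rwa [e]
      refine lemL' hs hc hd hnc C hC {q | q = u * u ∨ Cen q} ?_ ?_ _ (Or.inl rfl)
      · rintro t (rfl | ht) c hcc
        · exact Subring.subset_closure (Or.inr (hq c hcc))
        · rw [ht c, sub_self]; exact Subring.zero_mem _
      · rintro a (rfl | ha) b (rfl | hb)
        · rfl
        · exact (hb _).symm
        · exact ha _
        · exact ha _
    obtain ⟨w, hwd⟩ : ∃ w, w = v * y := ⟨_, rfl⟩
    have hw : u * w - w * u = 1 := by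
      rw [hwd, ← hzy, hzd]
      linear_combination (norm := noncomm_ring) -v * hy u
    have hww : Cen (w * w) := fun s => by
      rw [hwd]
      have e := hsq v hv s
      linear_combination (norm := noncomm_ring) v * hy v * (y * s) - s * v * hy v * y
        + v * v * hy (y * s) + v * v * hy s * y + e * (y * y)
    refine hd4 (dim4 h2 u w (hsq u hu) hw ?_)
    have hP : ∀ a, a * u = u * a → a + u * (w * a - a * w) ∈ U := fun a ha => by
      rw [P_id u w a hw ha]
      exact hU _ (hC (a * w) (u * w)) u hu
    have hB : ∀ b b', b * u = u * b → b * w = w * b → b' * u = u * b' → b' * w = w * b' →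
        b * b' = b' * b := by
      have hBU : ∀ b, b * u = u * b → b * w = w * b → b ∈ U := fun b h1 h2 => by
        have := hP b h1
        rwa [h2, sub_self, mul_zero, add_zero] at this
      intro b b' h1 h2 h3 h4
      refine comm_zero hc b b' (hUU _ (hBU _ h1 h2) _ (hBU _ h3 h4))
        (hUU _ (hBU _ h1 h2) _ (hBU _ ?_ ?_))
      · linear_combination (norm := noncomm_ring) b * h3 + h1 * b'
      · linear_combination (norm := noncomm_ring) b * h4 + h2 * b'
    have hdec : ∀ a, a * u = u * a → ∃ b b', b * u = u * b ∧ b * w = w * b ∧ b' * u = u * b' ∧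
        b' * w = w * b' ∧ a = b + u * b' := fun a ha => by
      have hdel : (w * a - a * w) * u = u * (w * a - a * w) := by
        linear_combination (norm := noncomm_ring) w * ha - ha * w - hw * a + a * hw
      have hdw : (w * a - a * w) * w = w * (w * a - a * w) := by
        linear_combination (norm := noncomm_ring) hww a + n2 (w * a * w) - n2 (w * w * a)
      refine ⟨a - u * (w * a - a * w), w * a - a * w, ?_, ?_, hdel, hdw, by noncomm_ring⟩
      · linear_combination (norm := noncomm_ring) ha - u * hdel
      · linear_combination (norm := noncomm_ring) -u * hdw - hw * (w * a - a * w)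
          - n2 (w * a - a * w)
    intro a a' ha ha'
    obtain ⟨b, c, h1, h2, h3, h4, rfl⟩ := hdec a ha
    obtain ⟨b', c', h1', h2', h3', h4', rfl⟩ := hdec a' ha'
    have e1 := hB b b' h1 h2 h1' h2'
    have e2 := hB b c' h1 h2 h3' h4'
    have e3 := hB c b' h3 h4 h1' h2'
    have e4 := hB c c' h3 h4 h3' h4'
    linear_combination (norm := noncomm_ring) e1 + h1 * c' + u * e2 - h1' * c + u * e3
      + u * h3 * c' + u * u * e4 - u * h3' * c
  · have h1 := hUU u hu _ (hU' u hu _ (hC v (u * u * (v * v))))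
    have e : u * (u * (v * (u * u * (v * v)) - u * u * (v * v) * v) -
        (v * (u * u * (v * v)) - u * u * (v * v) * v) * u) -
        (u * (v * (u * u * (v * v)) - u * u * (v * v) * v) -
        (v * (u * u * (v * v)) - u * u * (v * v) * v) * u) * u = u * (-(4 : S) * (z * z * z)) := by
      have e1 : v * (u * u * (v * v)) - u * u * (v * v) * v = -(2 : S) * (z * (u * (v * v))) := by
        linear_combination (norm := noncomm_ring) hzd * (u * (v * v)) + u * hzd * (v * v)
          + hz u * (v * v)
      have e2 : u * (-(2 : S) * (z * (u * (v * v)))) - -(2 : S) * (z * (u * (v * v))) * u =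
          -(4 : S) * (z * (z * (u * v))) := by
        linear_combination (norm := noncomm_ring) (2 : S) * hz u * (u * (v * v))
          + (2 : S) * (z * u) * hzd * v + (2 : S) * (z * u * v) * hzd + (2 : S) * (z * u) * hz v
          + (4 : S) * z * hz u * v
      rw [e1, e2]
      linear_combination (norm := noncomm_ring) (4 : S) * hz u * (z * u * v)
          + (4 : S) * z * hz u * (u * v) + (4 : S) * (z * z * u) * hzd
          - (4 : S) * z * hz u * z - (4 : S) * hz u * (z * z)
    rw [e] at h1
    have hcz : Cen (-(4 : S) * (z * z * z)) := by
      intro s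
      linear_combination (norm := noncomm_ring) -(4 : S) * hz s * (z * z) - (4 : S) * z * hz s * z
        - (4 : S) * (z * z) * hz s
    have hne0 : -(4 : S) * (z * z * z) ≠ 0 := by
      intro h
      have h3 : (z * z * z) * (y * y * y) = 1 := by
        linear_combination (norm := noncomm_ring) z * z * hzy * (y * y) + z * hzy * y + hzy
      have h4 : (2 : S) + 2 = 0 := by
        have h5 : (2 : S) + 2 = 4 := by norm_num
        rw [h5]
        linear_combination (norm := noncomm_ring) -(4 : S) * h3 - h * (y * y * y)
      exact h2 (two_cancel hs h2 2 h4)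
    exact huv (cen_of_mul hc _ u hcz hne0 h1 v)

end Herst

/-- Herstein's theorem: if `S` is a simple unital ring whose center is a field,
and either `char S ≠ 2` or `S` is not 4-dimensional over its center, then every
proper Lie ideal `U` of the Lie ring `[S,S]` is contained in the center. -/
theorem stmt_9 (S : Type*) [Ring S] [Nontrivial S]
    (hsimple : ∀ I : TwoSidedIdeal S, I = ⊥ ∨ I = ⊤)
    (hcenter : IsField (Subring.center S))
    (hdim : ringChar S ≠ 2 ∨ Module.finrank (Subring.center S) S ≠ 4)
    (C : AddSubgroup S)
    (hC : C = AddSubgroup.closure {z : S | ∃ x y : S, z = x * y - y * x})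
    (U : AddSubgroup S) (hUC : U ≤ C)
    (hLie : ∀ x ∈ C, ∀ y ∈ U, x * y - y * x ∈ U)
    (hproper : U ≠ C) :
    (U : Set S) ⊆ Subring.center S := by
  intro x hx
  refine Subring.mem_center_iff.2 fun g => Eq.symm ?_
  by_cases hnc : ∃ p q : S, p * q ≠ q * p
  swap
  · push Not at hnc; exact hnc x g
  have hd : (2 : S) ≠ 0 ∨ Module.finrank (Subring.center S) S ≠ 4 := by
    refine hdim.imp_left fun h h2 => h ?_
    have h3 : ringChar S ∣ 2 := ringChar.dvd (by exact_mod_cast h2)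
    rcases (Nat.dvd_prime Nat.prime_two).1 h3 with h4 | h4
    · exfalso
      have := ringChar.spec S 1
      rw [h4] at this
      simp at this
    · exact h4
  refine Herst.final hsimple hcenter hd hnc C (fun a b => ?_) U hLie ?_ x hx g
  · rw [hC]; exact AddSubgroup.subset_closure ⟨a, b, rfl⟩
  · by_contra! h
    apply hproper
    refine le_antisymm hUC ?_
    rw [hC, AddSubgroup.closure_le]
    rintro _ ⟨a, b, rfl⟩
    exact h a b
end

section
/- Let R be a simple unital associative algebra over a field K with Z(R) = K·1 such that [[R,R],[R,R]] ≠ 0, and suppose either char(K) ≠ 2 or dim_K R ≠ 4. If 1 ∉ [R,R], then the Lie K-algebra [R,R] is simple. -/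
section Aux

variable {K : Type*} [Field K] {R : Type*} [Ring R] [Algebra K R]

/-- In a simple ring, a set closed under the ideal operations with a nonzero element contains 1. -/
theorem aux_ideal [Nontrivial R] (hsimple : ∀ I : TwoSidedIdeal R, I = ⊥ ∨ I = ⊤)
    (P : R → Prop) (h0 : P 0) (hadd : ∀ a b, P a → P b → P (a + b)) (hneg : ∀ a, P a → P (-a))
    (hl : ∀ r a, P a → P (r * a)) (hr : ∀ r a, P a → P (a * r))
    (a : R) (ha : P a) (hne : a ≠ 0) : P 1 := by
  let J : TwoSidedIdeal R := TwoSidedIdeal.mk' {x | P x} h0 (fun {x y} hx hy => hadd x y hx hy)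
    (fun {x} hx => hneg x hx) (fun {x y} hy => hl x y hy) (fun {x y} hx => hr y x hx)
  have hJ : ∀ x, x ∈ J ↔ P x := fun x => by
    simp only [J, TwoSidedIdeal.mem_mk']; rfl
  rcases hsimple J with h | h
  · exfalso
    have : a ∈ J := (hJ a).2 ha
    rw [h, TwoSidedIdeal.mem_bot] at this
    exact hne this
  · rw [← hJ, h]; exact TwoSidedIdeal.mem_top R

theorem aux_prime [Nontrivial R] (hsimple : ∀ I : TwoSidedIdeal R, I = ⊥ ∨ I = ⊤)
    (a b : R) (h : ∀ y, a * y * b = 0) (ha : a ≠ 0) : b = 0 := by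
  have := aux_ideal hsimple (fun x => ∀ y, x * y * b = 0) (by simp)
    (fun x y hx hy z => by rw [add_mul, add_mul, hx, hy, add_zero])
    (fun x hx z => by rw [neg_mul, neg_mul, hx, neg_zero])
    (fun r x hx y => by rw [mul_assoc r, mul_assoc r, hx, mul_zero])
    (fun r x hx y => by rw [mul_assoc x, hx]) a h ha 1
  simpa using this

theorem aux_A [Nontrivial R] (hsimple : ∀ I : TwoSidedIdeal R, I = ⊥ ∨ I = ⊤)
    (hcenter : (Subring.center R : Set R) = Set.range (algebraMap K R))
    (C : Submodule K R) (hcC : ∀ x y : R, x * y - y * x ∈ C) (hone : (1 : R) ∉ C)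
    (W : Subalgebra K R)
    (hW : ∀ w ∈ W, ∀ x y : R, w * (x * y - y * x) - (x * y - y * x) * w ∈ W)
    (u : R) (hu : u ∈ W) (x₀ : R) (hx₀ : u * x₀ - x₀ * u ≠ 0) : ∀ r, r ∈ W := by
  -- step 1
  have step1 : ∀ t ∈ W, ∀ r, t * r - r * t ∈ W := by
    intro t ht r
    by_cases hc : ∀ x, t * x - x * t = 0
    · rw [hc]; exact W.zero_mem
    push Not at hc
    obtain ⟨x, hx⟩ := hc
    have key := aux_ideal hsimple (fun a => ∀ y z, t * (y * a * z) - (y * a * z) * t ∈ W)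
      (by intro y z; simp)
      (fun a b ha hb y z => by
        have := W.add_mem (ha y z) (hb y z)
        convert this using 1; noncomm_ring)
      (fun a ha y z => by
        have := W.neg_mem (ha y z)
        convert this using 1; noncomm_ring)
      (fun r a ha y z => by
        have := ha (y * r) z
        simpa only [mul_assoc] using this)
      (fun r a ha y z => by
        have := ha y (r * z)
        simpa only [mul_assoc] using this)
      (t * x - x * t)
      (by
        have h1 : ∀ y, t * (y * (t * x - x * t)) - (y * (t * x - x * t)) * t ∈ W := by
          intro y
          have := W.sub_mem (W.mul_mem (hW t ht x y) ht) (hW t ht x (y * t))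
          convert this using 1; noncomm_ring
        intro y z
        have := W.add_mem (hW t ht (y * (t * x - x * t)) z) (h1 (z * y))
        convert this using 1; noncomm_ring) hx
    simpa using key r 1
  by_cases hcomm : ∃ t ∈ W, ∃ w ∈ W, t * w - w * t ≠ 0
  · obtain ⟨t, ht, w, hw, hne⟩ := hcomm
    have key := aux_ideal hsimple (fun a => ∀ y z, y * a * z ∈ W)
      (by intro y z; simp)
      (fun a b ha hb y z => by
        have := W.add_mem (ha y z) (hb y z)
        convert this using 1; noncomm_ring)
      (fun a ha y z => by
        have := W.neg_mem (ha y z)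
        convert this using 1; noncomm_ring)
      (fun r a ha y z => by
        have := ha (y * r) z
        simpa only [mul_assoc] using this)
      (fun r a ha y z => by
        have := ha y (r * z)
        simpa only [mul_assoc] using this)
      (t * w - w * t)
      (by
        have h1 : ∀ x, (t * w - w * t) * x ∈ W := by
          intro x
          have := W.sub_mem (step1 t ht (w * x)) (W.mul_mem hw (step1 t ht x))
          convert this using 1; noncomm_ring
        intro y z
        have := W.sub_mem (h1 (z * y)) (step1 _ (h1 z) y)
        convert this using 1; noncomm_ring) hne
    intro r
    simpa using key r 1
  exfalso
  push Not at hcomm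
  have hd2 : ∀ t ∈ W, ∀ y, t * (t * y - y * t) - (t * y - y * t) * t = 0 :=
    fun t ht y => hcomm t ht _ (step1 t ht y)
  by_cases h2 : (2 : K) = 0
  · have h2R : ∀ r : R, r + r = 0 := by
      intro r
      have : (algebraMap K R 2) * r = r + r := by
        rw [map_ofNat, two_mul]
      rw [← this, h2, map_zero, zero_mul]
    have hsq : ∀ t ∈ W, ∀ x, (t * x - x * t) * (t * x - x * t) = 0 := by
      intro t ht x
      obtain ⟨v, hv⟩ : ∃ v, v = t * x - x * t := ⟨_, rfl⟩
      have hvW : v ∈ W := hv ▸ step1 t ht x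
      rw [← hv]
      have hcen : v * v ∈ (Subring.center R : Set R) := by
        rw [SetLike.mem_coe, Subring.mem_center_iff]
        intro g
        have h3 := hd2 v hvW g
        have h4 := h2R (v * g * v)
        have h5 := h2R (g * (v * v))
        have : v * v * g - g * (v * v) = v * (v * g - g * v) - (v * g - g * v) * v
            + (v * g * v + v * g * v) - (g * (v * v) + g * (v * v)) := by noncomm_ring
        rw [h3, h4, h5, add_zero, sub_zero] at this
        exact (sub_eq_zero.1 this).symm
      rw [hcenter] at hcen
      obtain ⟨k, hk⟩ := hcen
      by_cases hk0 : k = 0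
      · rw [← hk, hk0, map_zero]
      exfalso
      apply hone
      have h6 : t * (x * v) - (x * v) * t = v * v := by
        have h7 := hcomm t ht v hvW
        have : t * (x * v) - (x * v) * t = (t * x - x * t) * v + x * (t * v - v * t) := by
          noncomm_ring
        rw [this, h7, ← hv, mul_zero, add_zero]
      have h8 := C.smul_mem k⁻¹ (hcC t (x * v))
      rw [h6, ← hk, Algebra.smul_def, ← map_mul, inv_mul_cancel₀ hk0, map_one] at h8
      exact h8
    obtain ⟨v, hv⟩ : ∃ v, v = u * x₀ - x₀ * u := ⟨_, rfl⟩
    have hvW : v ∈ W := hv ▸ step1 u hu x₀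
    have hv0 : v ≠ 0 := hv ▸ hx₀
    have hvv : v * v = 0 := by rw [hv]; exact hsq u hu x₀
    have h9 : ∀ y, v * y * v * y * v = 0 := by
      intro y
      have h := congrArg (fun z => v * z) (hsq v hvW y)
      have e : v * ((v * y - y * v) * (v * y - y * v))
        = (v * v) * y * (v * y - y * v) - v * y * (v * v) * y + v * y * v * y * v := by noncomm_ring
      simp only [e, hvv] at h
      simpa using h
    have h10 : ∀ y z, v * y * v * z * v + v * z * v * y * v = 0 := by
      intro y z
      have h := h9 (y + z)
      have e : v * (y + z) * v * (y + z) * v = v * y * v * y * v + v * z * v * z * v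
        + (v * y * v * z * v + v * z * v * y * v) := by noncomm_ring
      rw [e, h9, h9] at h
      simpa using h
    have h11 : ∀ y, v * y * v = 0 := by
      intro y
      by_contra hne
      apply hne
      refine aux_prime hsimple (v * y * v) (v * y * v) (fun z => ?_) hne
      have h := congrArg (fun q => q * y * v) (h10 y z)
      have h' := h9 y
      have e : (v * y * v * z * v + v * z * v * y * v) * y * v
        = v * y * v * z * (v * y * v) + v * z * (v * y * v * y * v) := by noncomm_ring
      simp only [e, h'] at h
      simpa using h
    exact hv0 (aux_prime hsimple v v h11 hv0)
  · have hdd : ∀ x y, (u * x - x * u) * (u * y - y * u) = 0 := by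
      intro x y
      have e : (u * (u * (x * y) - (x * y) * u) - (u * (x * y) - (x * y) * u) * u)
        = (u * (u * x - x * u) - (u * x - x * u) * u) * y
          + x * (u * (u * y - y * u) - (u * y - y * u) * u)
          + 2 * ((u * x - x * u) * (u * y - y * u)) := by noncomm_ring
      rw [hd2 u hu, hd2 u hu, hd2 u hu, zero_mul, mul_zero, zero_add, zero_add] at e
      have h3 : (2 : K) • ((u * x - x * u) * (u * y - y * u)) = 0 := by
        rw [Algebra.smul_def, map_ofNat]; exact e.symm
      exact (smul_eq_zero.1 h3).resolve_left h2
    refine hx₀ (aux_prime hsimple _ (u * x₀ - x₀ * u) (fun y => ?_) hx₀)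
    have e : (u * x₀ - x₀ * u) * (u * (y * x₀) - (y * x₀) * u)
      = (u * x₀ - x₀ * u) * (u * y - y * u) * x₀
        + (u * x₀ - x₀ * u) * y * (u * x₀ - x₀ * u) := by noncomm_ring
    rw [hdd, hdd, zero_mul, zero_add] at e
    exact e.symm

end Aux

/-- Let `R` be a simple unital associative algebra over a field `K` with
`Z(R) = K·1`, `[[R,R],[R,R]] ≠ 0`, and either `char K ≠ 2` or `dim_K R ≠ 4`.
If `1 ∉ [R,R]`, then the Lie `K`-algebra `[R,R]` is simple. -/
theorem stmt_10 (K : Type*) [Field K] (R : Type*) [Ring R] [Algebra K R]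
    [Nontrivial R]
    (hsimple : ∀ I : TwoSidedIdeal R, I = ⊥ ∨ I = ⊤)
    (hcenter : (Subring.center R : Set R) = Set.range (algebraMap K R))
    (C : Submodule K R)
    (hC : C = Submodule.span K {z : R | ∃ x y : R, z = x * y - y * x})
    (hdouble : ∃ a ∈ C, ∃ b ∈ C, a * b - b * a ≠ 0)
    (hdim : ringChar K ≠ 2 ∨ Module.finrank K R ≠ 4)
    (hone : (1 : R) ∉ C) :
    C ≠ ⊥ ∧
      ∀ I : Submodule K R, I ≤ C → (∀ x ∈ C, ∀ y ∈ I, x * y - y * x ∈ I) →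
        I = ⊥ ∨ I = C := by
  have hcC : ∀ x y : R, x * y - y * x ∈ C := by
    intro x y; rw [hC]; exact Submodule.subset_span ⟨x, y, rfl⟩
  obtain ⟨a, ha, b, hb, hab⟩ := hdouble
  refine ⟨?_, ?_⟩
  · rintro rfl
    rw [Submodule.mem_bot] at ha
    apply hab; rw [ha]; simp
  intro I hIC hI
  have hzero : ∀ z ∈ C, (∀ r, z * r - r * z = 0) → z = 0 := by
    intro z hz hr
    have : z ∈ (Subring.center R : Set R) := by
      rw [SetLike.mem_coe, Subring.mem_center_iff]
      intro g; exact (sub_eq_zero.1 (hr g)).symm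
    rw [hcenter] at this
    obtain ⟨k, rfl⟩ := this
    by_cases hk : k = 0
    · rw [hk, map_zero]
    exfalso
    apply hone
    have h8 := C.smul_mem k⁻¹ hz
    rwa [Algebra.smul_def, ← map_mul, inv_mul_cancel₀ hk, map_one] at h8
  let T : Subalgebra K R :=
    { carrier := {t | ∀ r, t * r - r * t ∈ I}
      mul_mem' := by
        intro s t hs ht r
        have := I.add_mem (hs (t * r)) (ht (r * s))
        convert this using 1; noncomm_ring
      add_mem' := by
        intro s t hs ht r
        have := I.add_mem (hs r) (ht r)
        convert this using 1; noncomm_ring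
      algebraMap_mem' := by
        intro k r
        rw [Algebra.commutes, sub_self]; exact I.zero_mem }
  have hT : ∀ t, t ∈ T ↔ ∀ r, t * r - r * t ∈ I := fun t => Iff.rfl
  by_cases hTc : ∃ t ∈ T, ∃ x, t * x - x * t ≠ 0
  · right
    obtain ⟨t, ht, x, hx⟩ := hTc
    have hall := aux_A hsimple hcenter C hcC hone T (by
      intro w hw x y
      rw [hT] at hw ⊢
      intro r
      have := I.sub_mem (hw ((x * y - y * x) * r - r * (x * y - y * x)))
        (hI _ (hcC x y) _ (hw r))
      convert this using 1; noncomm_ring) t ht x hx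
    apply le_antisymm hIC
    rw [hC, Submodule.span_le]
    rintro z ⟨x, y, rfl⟩
    exact (hT x).1 (hall x) y
  left
  push Not at hTc
  have hIab : ∀ p ∈ I, ∀ q ∈ I, p * q = q * p := by
    intro p hp q hq
    refine sub_eq_zero.1 (hzero _ (hcC p q) (hTc _ ?_))
    rw [hT]
    intro r
    have := I.sub_mem (hI _ (hcC p r) _ hq) (hI _ (hcC q r) _ hp)
    convert this using 1; noncomm_ring
  have hWc : ∀ p ∈ Algebra.adjoin K (I : Set R), ∀ q ∈ Algebra.adjoin K (I : Set R),
      p * q = q * p := by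
    intro p hp q hq
    exact congrArg Subtype.val
      ((Algebra.adjoinCommRingOfComm K (s := (I : Set R)) hIab).mul_comm ⟨p, hp⟩ ⟨q, hq⟩)
  rw [eq_bot_iff]
  intro z hz
  rw [Submodule.mem_bot]
  refine hzero z (hIC hz) (fun r => ?_)
  by_contra hne
  have hall := aux_A hsimple hcenter C hcC hone (Algebra.adjoin K (I : Set R)) (by
    intro w hw x y
    induction hw using Algebra.adjoin_induction with
    | mem p hp =>
      apply Algebra.subset_adjoin
      have := I.neg_mem (hI _ (hcC x y) _ hp)
      simpa using this
    | algebraMap k => rw [Algebra.commutes, sub_self]; exact Subalgebra.zero_mem _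
    | add p q _ _ hp hq =>
      have := Subalgebra.add_mem _ hp hq
      convert this using 1; noncomm_ring
    | mul p q hp' hq' hp hq =>
      have := Subalgebra.add_mem _ (Subalgebra.mul_mem _ hp hq') (Subalgebra.mul_mem _ hp' hq)
      convert this using 1; noncomm_ring) z (Algebra.subset_adjoin hz) r hne
  exact hab (sub_eq_zero.2 (hWc a (hall a) b (hall b)))
end
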